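/- arXiv:math/0502414 — 2 statements merged into one kernel-verified Lean document; each statement's English description precedes it below -/
import Mathlib

section
/- (Sufficiency in the main theorem.) Suppose there exists a complete transfer operator δ* for (A, δ). Then there exist a complex Hilbert space H, an injective unital *-homomorphism π : A → B(H) into the bounded operators on H, and a bounded operator U ∈ B(H) such that for every a ∈ A: U·π(a)·U* = π(δ(a)), U*·π(a)·U = π(δ*(a)) (in particular U*·π(a)·U ∈ π(A)), and U·π(a) = π(δ(a))·U. -/
/-- A (not necessarily unital) *-algebra endomorphism of a unital C*-algebra:
a linear, multiplicative, star-preserving map. -/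
def IsEndomorphism {A : Type*} [CStarAlgebra A] (δ : A → A) : Prop :=
  IsLinearMap ℂ δ ∧ (∀ a b, δ (a * b) = δ a * δ b) ∧ (∀ a, δ (star a) = star (δ a))

/-- A transfer operator for `(A, δ)`: a continuous positive linear map `δs`
satisfying `δs (δ a * b) = a * δs b`. -/
def IsTransferOperator {A : Type*} [CStarAlgebra A] [PartialOrder A] [StarOrderedRing A]
    (δ δs : A → A) : Prop :=
  Continuous δs ∧ IsLinearMap ℂ δs ∧ (∀ a, 0 ≤ a → 0 ≤ δs a) ∧
    ∀ a b, δs (δ a * b) = a * δs b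

universe u

section PreHilbert

open UniformSpace Completion ContinuousLinearMap
open scoped ComplexOrder

/-- Bounded operators on a completion are determined by their matrix coefficients on the dense
subspace. -/
theorem UniformSpace.Completion.clm_ext_inner {E : Type*} [SeminormedAddCommGroup E]
    [InnerProductSpace ℂ E] {F G : Completion E →L[ℂ] Completion E}
    (h : ∀ x y : E, inner ℂ (F x) (y : Completion E) = inner ℂ (G x) (y : Completion E)) :
    F = G := by
  ext x
  refine ext_inner_right ℂ fun y => ?_
  induction x, y using induction_on₂ with
  | hp => apply isClosed_eq <;> fun_prop
  | ih x y => exact h x y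

/-- A unital `*`-representation of a C⋆-algebra on a semi-inner product space, satisfying its
identities only up to null vectors, is contractive. -/
theorem norm_apply_le_of_weak_representation {A E : Type*} [CStarAlgebra A] [PartialOrder A]
    [StarOrderedRing A] [SeminormedAddCommGroup E] [InnerProductSpace ℂ E] (L : A → E →ₗ[ℂ] E)
    (hadd : ∀ a b x y, inner ℂ (L (a + b) x) y = inner ℂ (L a x) y + inner ℂ (L b x) y)
    (hsmul : ∀ (c : ℂ) a x y, inner ℂ (L (c • a) x) y = inner ℂ (c • L a x) y)
    (hmul : ∀ a b x y, inner ℂ (L (a * b) x) y = inner ℂ (L a (L b x)) y)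
    (hone : ∀ x y, inner ℂ (L 1 x) y = inner ℂ x y)
    (hstar : ∀ a x y, inner ℂ (L a x) y = inner ℂ x (L (star a) y)) (a : A) (x : E) :
    ‖L a x‖ ≤ ‖a‖ * ‖x‖ := by
  have hsq (b : A) : inner ℂ (L (star b * b) x) x = ((‖L b x‖ ^ 2 : ℝ) : ℂ) := by
    rw [hmul, hstar, star_star, inner_self_eq_norm_sq_to_K]
    norm_cast
  have hle : star a * a ≤ algebraMap ℝ A (‖a‖ ^ 2) := by
    have := IsSelfAdjoint.le_algebraMap_norm_self (IsSelfAdjoint.star_mul_self a)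
    rwa [CStarRing.norm_star_mul_self, ← sq] at this
  obtain ⟨b, hb⟩ := CStarAlgebra.nonneg_iff_eq_star_mul_self.mp (sub_nonneg.mpr hle)
  have hsum : ((‖a‖ ^ 2 : ℝ) : ℂ) • (1 : A) = star a * a + star b * b := by
    rw [← hb, Algebra.algebraMap_eq_smul_one, Complex.coe_smul]
    abel
  have key := congrArg (fun c => inner ℂ (L c x) x) hsum
  simp only [hadd, hsq, hsmul, inner_smul_left, hone, inner_self_eq_norm_sq_to_K,
    Complex.conj_ofReal, RCLike.ofReal_eq_complex_ofReal] at key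
  have key' : ‖a‖ ^ 2 * ‖x‖ ^ 2 = ‖L a x‖ ^ 2 + ‖L b x‖ ^ 2 := by exact_mod_cast key
  refine le_of_sq_le_sq ?_ (by positivity)
  nlinarith [sq_nonneg ‖L b x‖]

/-- A representation, together with an adjoint pair of operators, given up to null vectors on a
semi-inner product space, extends to the Hilbert space completion. -/
theorem exists_completion_of_weak_representation {A E : Type*} [CStarAlgebra A] [PartialOrder A]
    [StarOrderedRing A] [SeminormedAddCommGroup E] [InnerProductSpace ℂ E] {δ δs : A → A}
    (L : A → E →ₗ[ℂ] E) (U V : E →ₗ[ℂ] E)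
    (hadd : ∀ a b x y, inner ℂ (L (a + b) x) y = inner ℂ (L a x) y + inner ℂ (L b x) y)
    (hsmul : ∀ (c : ℂ) a x y, inner ℂ (L (c • a) x) y = inner ℂ (c • L a x) y)
    (hmul : ∀ a b x y, inner ℂ (L (a * b) x) y = inner ℂ (L a (L b x)) y)
    (hone : ∀ x y, inner ℂ (L 1 x) y = inner ℂ x y)
    (hstar : ∀ a x y, inner ℂ (L a x) y = inner ℂ x (L (star a) y))
    (hadj : ∀ x y, inner ℂ (U x) y = inner ℂ x (V y))
    (hULV : ∀ a x y, inner ℂ (U (L a (V x))) y = inner ℂ (L (δ a) x) y)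
    (hVLU : ∀ a x y, inner ℂ (V (L a (U x))) y = inner ℂ (L (δs a) x) y)
    (hUL : ∀ a x y, inner ℂ (U (L a x)) y = inner ℂ (L (δ a) (U x)) y) :
    ∃ (π : A →⋆ₐ[ℂ] (Completion E →L[ℂ] Completion E)) (W : Completion E →L[ℂ] Completion E),
      (∀ a (x : E), π a x = (L a x : E)) ∧
      (∀ a : A, W * π a * star W = π (δ a)) ∧
      (∀ a : A, star W * π a * W = π (δs a)) ∧
      (∀ a : A, W * π a = π (δ a) * W) := by
  have hL := norm_apply_le_of_weak_representation L hadd hsmul hmul hone hstar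
  have hadj' (x y) : inner ℂ (V x) y = inner ℂ x (U y) := by
    rw [← inner_conj_symm, ← hadj, inner_conj_symm]
  have bound {P Q : E →ₗ[ℂ] E} {c : A}
      (h : ∀ x, inner ℂ (P x) (P x) = inner ℂ (L c x) x) (x : E) :
      ‖P x‖ ≤ √‖c‖ * ‖x‖ := by
    refine le_of_sq_le_sq ?_ (by positivity)
    rw [mul_pow, Real.sq_sqrt (norm_nonneg _)]
    calc ‖P x‖ ^ 2 = ‖inner ℂ (P x) (P x)‖ := by
          rw [inner_self_eq_norm_sq_to_K]; simp
      _ ≤ ‖L c x‖ * ‖x‖ := by rw [h]; exact norm_inner_le_norm _ _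
      _ ≤ ‖c‖ * ‖x‖ ^ 2 := by nlinarith [hL c x, norm_nonneg x]
  have hU (x) : ‖U x‖ ≤ √‖δs 1‖ * ‖x‖ := bound (Q := V) (fun x => by
    rw [← hVLU, hadj', hone]) x
  have hV (x) : ‖V x‖ ≤ √‖δ 1‖ * ‖x‖ := bound (Q := V) (fun x => by
    rw [← hULV, hadj, hone]) x
  let L' (a : A) : Completion E →L[ℂ] Completion E := ((L a).mkContinuous _ (hL a)).completion
  let U' : Completion E →L[ℂ] Completion E := (U.mkContinuous _ hU).completion
  let V' : Completion E →L[ℂ] Completion E := (V.mkContinuous _ hV).completion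
  have L'_coe (a) (x : E) : L' a x = (L a x : E) := by simp [L']
  have U'_coe (x : E) : U' x = (U x : E) := by simp [U']
  have V'_coe (x : E) : V' x = (V x : E) := by simp [V']
  have L'_one : L' 1 = 1 := clm_ext_inner fun x y => by simp [L'_coe, hone]
  have L'_smul (c : ℂ) (a : A) : L' (c • a) = c • L' a := clm_ext_inner fun x y => by
    simp only [smul_apply, L'_coe, ← Completion.coe_smul, inner_coe, hsmul]
  have L'_add (a b : A) : L' (a + b) = L' a + L' b := clm_ext_inner fun x y => by
    simp only [add_apply, L'_coe, ← Completion.coe_add, inner_coe, hadd, inner_add_left]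
  have star_U' : star U' = V' := by
    refine ((eq_adjoint_iff V' U').mpr fun x y => ?_).symm
    induction x, y using induction_on₂ with
    | hp => apply isClosed_eq <;> fun_prop
    | ih x y => simp only [V'_coe, U'_coe, inner_coe, hadj']
  let π : A →⋆ₐ[ℂ] (Completion E →L[ℂ] Completion E) :=
    { toFun := L'
      map_one' := L'_one
      map_mul' a b := clm_ext_inner fun x y => by
        simp only [mul_apply_eq_comp, L'_coe, inner_coe, hmul]
      map_zero' := by simpa using L'_smul 0 0
      map_add' := L'_add
      commutes' c := by
        rw [Algebra.algebraMap_eq_smul_one, L'_smul, L'_one, Algebra.algebraMap_eq_smul_one]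
      map_star' a := by
        refine (eq_adjoint_iff (L' (star a)) (L' a)).mpr fun x y => ?_
        induction x, y using induction_on₂ with
        | hp => apply isClosed_eq <;> fun_prop
        | ih x y => simp only [L'_coe, inner_coe, hstar, star_star] }
  have π_coe (a) (x : E) : π a x = (L a x : E) := L'_coe a x
  refine ⟨π, U', π_coe, fun a => ?_, fun a => ?_, fun a => ?_⟩
  all_goals
    refine clm_ext_inner fun x y => ?_
    simp only [star_U', mul_apply_eq_comp, π_coe, U'_coe, V'_coe, inner_coe, hULV, hVLU,
      hUL]

end PreHilbert

section DirectSum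

open Finsupp
open scoped ComplexOrder

variable {A ι : Type*} [CStarAlgebra A] [PartialOrder A] [StarOrderedRing A]

/-- The semi-inner product on finitely supported families in `A` whose `i`-th component is
`(x, y) ↦ φ i (star x * (e i * y))`, where `e i` is a projection. -/
noncomputable abbrev finsuppPreInnerCore (φ : ι → A →ₚ[ℂ] ℂ) (e : ι → A)
    (he : ∀ i, IsStarProjection (e i)) : PreInnerProductSpace.Core ℂ (ι →₀ A) where
  inner x y := x.sum fun i a => φ i (star a * (e i * y i))
  conj_inner_symm x y := by
    classical
    have hx : x.sum (fun i a => φ i (star a * (e i * y i))) =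
        ∑ i ∈ x.support ∪ y.support, φ i (star (x i) * (e i * y i)) :=
      sum_of_support_subset _ Finset.subset_union_left _ (by simp)
    have hy : y.sum (fun i a => φ i (star a * (e i * x i))) =
        ∑ i ∈ x.support ∪ y.support, φ i (star (y i) * (e i * x i)) :=
      sum_of_support_subset _ Finset.subset_union_right _ (by simp)
    rw [hx, hy, map_sum]
    refine Finset.sum_congr rfl fun i _ => ?_
    rw [← Complex.star_def, ← map_star (φ i)]
    simp [(he i).isSelfAdjoint.star_eq, mul_assoc]
  re_inner_nonneg x := by
    rw [Finsupp.sum, map_sum]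
    refine Finset.sum_nonneg fun i _ => ?_
    have h : star (x i) * (e i * x i) = star (e i * x i) * (e i * x i) := by
      rw [star_mul, (he i).isSelfAdjoint.star_eq, mul_assoc, ← mul_assoc (e i) (e i),
        (he i).isIdempotentElem.eq]
    rw [h]
    exact (RCLike.nonneg_iff.mp ((φ i).map_nonneg (star_mul_self_nonneg _))).1
  add_left x y z := sum_add_index' (by simp) (by simp [add_mul])
  smul_left x y c := by
    rw [sum_smul_index' (by simp), Finsupp.sum, Finsupp.sum, Finset.mul_sum]
    simp

/-- Data on the components of a direct sum of copies of `A`, compatible with a shift `s` of the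
index set, give a covariant representation. -/
theorem exists_covariant_representation_of_shift {A ι : Type u} [CStarAlgebra A] [PartialOrder A]
    [StarOrderedRing A] {δ δs : A → A} (φ : ι → A →ₚ[ℂ] ℂ)
    (D : ι → A →⋆ₙₐ[ℂ] A) (s : Equiv.Perm ι) (u v : ι → A →ₗ[ℂ] A)
    (hadj : ∀ i x y, φ (s i) (star (u i x) * (D (s i) 1 * y)) = φ i (star x * (D i 1 * v i y)))
    (hULV : ∀ i a x y, φ (s i) (star (u i (D i a * v i x)) * (D (s i) 1 * y)) =
      φ (s i) (star (D (s i) (δ a) * x) * (D (s i) 1 * y)))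
    (hVLU : ∀ i a x y, φ i (star (v i (D (s i) a * u i x)) * (D i 1 * y)) =
      φ i (star (D i (δs a) * x) * (D i 1 * y)))
    (hUL : ∀ i a x y, φ (s i) (star (u i (D i a * x)) * (D (s i) 1 * y)) =
      φ (s i) (star (D (s i) (δ a) * u i x) * (D (s i) 1 * y))) :
    ∃ (H : Type u) (_ : NormedAddCommGroup H) (_ : InnerProductSpace ℂ H)
      (_ : CompleteSpace H) (π : A →⋆ₐ[ℂ] (H →L[ℂ] H)) (U : H →L[ℂ] H),
      (∀ a, π a = 0 → ∀ i, φ i (D i (star a * a)) = 0) ∧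
      (∀ a : A, U * π a * star U = π (δ a)) ∧
      (∀ a : A, star U * π a * U = π (δs a)) ∧
      (∀ a : A, U * π a = π (δ a) * U) := by
  classical
  let c := finsuppPreInnerCore φ (fun i => D i 1) fun i => IsStarProjection.one A |>.map (D i)
  let _ : SeminormedAddCommGroup (ι →₀ A) :=
    InnerProductSpace.Core.toSeminormedAddCommGroup (𝕜 := ℂ) (c := c)
  let _ : InnerProductSpace ℂ (ι →₀ A) := InnerProductSpace.ofCore c
  have inner_single (i j : ι) (a b : A) : inner ℂ (single i a) (single j b) =
      if i = j then φ i (star a * (D i 1 * b)) else 0 := by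
    change (single i a).sum (fun k a => φ k (star a * (D k 1 * single j b k))) = _
    rw [sum_single_index (by simp), single_apply]
    by_cases h : i = j
    · simp [h]
    · simp [h, Ne.symm h]
  have ext_single {P Q R S : (ι →₀ A) →ₗ[ℂ] (ι →₀ A)}
      (h : ∀ i j a b, inner ℂ (P (single i a)) (R (single j b)) =
        inner ℂ (Q (single i a)) (S (single j b))) (x y : ι →₀ A) :
      inner ℂ (P x) (R y) = inner ℂ (Q x) (S y) := by
    induction x using induction_linear with
    | zero => simp
    | add x x' hx hx' => simp only [map_add, inner_add_left, hx, hx']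
    | single i a =>
      induction y using induction_linear with
      | zero => simp
      | add y y' hy hy' => simp only [map_add, inner_add_right, hy, hy']
      | single j b => exact h i j a b
  let L (a : A) : (ι →₀ A) →ₗ[ℂ] (ι →₀ A) :=
    lsum ℂ fun i => lsingle i ∘ₗ LinearMap.mulLeft ℂ (D i a)
  let U : (ι →₀ A) →ₗ[ℂ] (ι →₀ A) := lsum ℂ fun i => lsingle (s i) ∘ₗ u i
  let V : (ι →₀ A) →ₗ[ℂ] (ι →₀ A) := lsum ℂ fun i => lsingle (s.symm i) ∘ₗ v (s.symm i)
  have L_single (a i x) : L a (single i x) = single i (D i a * x) := by simp [L]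
  have U_single (i x) : U (single i x) = single (s i) (u i x) := by simp [U]
  have V_single (i x) : V (single (s i) x) = single i (v i x) := by simp [V]
  have D_one (i a) : D i a * D i 1 = D i a := by rw [← map_mul, mul_one]
  have one_D (i a) : D i 1 * D i a = D i a := by rw [← map_mul, one_mul]
  obtain ⟨π, W, hπ, h₁, h₂, h₃⟩ := exists_completion_of_weak_representation (δ := δ) (δs := δs)
    L U V
    (fun a b x y => by
      rw [← inner_add_left]
      exact ext_single (P := L (a + b)) (Q := L a + L b) (R := .id) (S := .id)
        (fun i j x y => by simp [L_single, add_mul]) x y)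
    (fun c a x y => ext_single (P := L (c • a)) (Q := c • L a) (R := .id) (S := .id)
        (fun i j x y => by
          rw [LinearMap.smul_apply, L_single, L_single, map_smul, smul_mul_assoc, smul_single]) x y)
    (fun a b x y => ext_single (P := L (a * b)) (Q := L a ∘ₗ L b) (R := .id) (S := .id)
        (fun i j x y => by
          simp only [LinearMap.comp_apply, L_single, map_mul, mul_assoc]) x y)
    (fun x y => ext_single (P := L 1) (Q := .id) (R := .id) (S := .id)
        (fun i j x y => by
          simp only [L_single, inner_single, LinearMap.id_apply]
          rw [star_mul, ← map_star, star_one, mul_assoc, ← mul_assoc (D i _)]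
          split_ifs with h
          · rw [D_one]
          · rfl) x y)
    (fun a x y => ext_single (P := L a) (Q := .id) (R := .id) (S := L (star a))
        (fun i j x y => by
          simp only [L_single, inner_single, LinearMap.id_apply]
          split_ifs with h
          · subst h
            rw [star_mul, ← map_star, mul_assoc, ← mul_assoc (D i _) (D i 1), D_one,
              ← mul_assoc (D i 1), one_D]
          · rfl) x y)
    (fun x y => ext_single (P := U) (Q := .id) (R := .id) (S := V)
        (fun i j x y => by
          obtain ⟨j, rfl⟩ := s.surjective j
          simp only [U_single, V_single, inner_single, LinearMap.id_apply,
            s.injective.eq_iff, hadj]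
          split_ifs with h
          · rw [h]
          · rfl) x y)
    (fun a x y => ext_single (P := U ∘ₗ L a ∘ₗ V) (Q := L (δ a)) (R := .id) (S := .id)
        (fun i j x y => by
          obtain ⟨i, rfl⟩ := s.surjective i
          simp only [LinearMap.comp_apply, U_single, V_single, L_single, inner_single,
            LinearMap.id_apply, hULV]) x y)
    (fun a x y => ext_single (P := V ∘ₗ L a ∘ₗ U) (Q := L (δs a)) (R := .id) (S := .id)
        (fun i j x y => by
          simp only [LinearMap.comp_apply, U_single, V_single, L_single, inner_single,
            LinearMap.id_apply, hVLU]) x y)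
    (fun a x y => ext_single (P := U ∘ₗ L a) (Q := L (δ a) ∘ₗ U) (R := .id) (S := .id)
        (fun i j x y => by
          simp only [LinearMap.comp_apply, U_single, L_single, inner_single,
            LinearMap.id_apply, hUL]) x y)
  refine ⟨UniformSpace.Completion (ι →₀ A), inferInstance, inferInstance, inferInstance, π, W,
    fun a ha i => ?_, h₁, h₂, h₃⟩
  have h := hπ a (single i (D i 1))
  rw [ha, _root_.zero_apply, L_single, D_one] at h
  have h0 := UniformSpace.Completion.inner_coe (𝕜 := ℂ) (single i (D i a)) (single i (D i a))
  rw [← h, inner_zero_left, inner_single, if_pos rfl, one_D, ← map_star, ← map_mul] at h0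
  exact h0.symm

end DirectSum

section Covariance

open scoped ComplexOrder

/-- The functional `f ∘ T^n`. -/
noncomputable def PositiveLinearMap.compIterate {A : Type*} [CStarAlgebra A] [PartialOrder A]
    (T : A →ₚ[ℂ] A) (f : A →ₚ[ℂ] ℂ) : ℕ → A →ₚ[ℂ] ℂ
  | 0 => f
  | n + 1 => (compIterate T f n).comp T

/-- A transfer operator `T` with `δ (T a) = δ 1 * a * δ 1` yields a covariant representation whose
kernel is annihilated by all positive functionals. It acts on a direct sum over `ℤ` that extends each
GNS space forwards by the functionals `f ∘ T^n` and backwards by the corners cut by `δ^n 1`. -/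
theorem exists_covariant_representation {A : Type u} [CStarAlgebra A] [PartialOrder A]
    [StarOrderedRing A] (δ : A →⋆ₙₐ[ℂ] A) (T : A →ₚ[ℂ] A)
    (hT : ∀ a b, T (δ a * b) = a * T b) (hc : ∀ a, δ (T a) = δ 1 * a * δ 1) :
    ∃ (H : Type u) (_ : NormedAddCommGroup H) (_ : InnerProductSpace ℂ H)
      (_ : CompleteSpace H) (π : A →⋆ₐ[ℂ] (H →L[ℂ] H)) (U : H →L[ℂ] H),
      (∀ a, π a = 0 → ∀ f : A →ₚ[ℂ] ℂ, f (star a * a) = 0) ∧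
      (∀ a : A, U * π a * star U = π (δ a)) ∧
      (∀ a : A, star U * π a * U = π (T a)) ∧
      (∀ a : A, U * π a = π (δ a) * U) := by
  have hT' (a b : A) : T (b * δ a) = T b * a := by
    have := congrArg star (hT (star a) (star b))
    simpa [← map_star] using this
  have δ_pow (n : ℕ) (a : A) : (δ ^ (n + 1)) a = (δ ^ n) (δ a) := by rw [pow_succ]; rfl
  have D_one (n : ℕ) (a : A) : (δ ^ n) a * (δ ^ n) 1 = (δ ^ n) a := by rw [← map_mul, mul_one]
  have one_D (n : ℕ) (a : A) : (δ ^ n) 1 * (δ ^ n) a = (δ ^ n) a := by rw [← map_mul, one_mul]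
  have δ_one_mul (a : A) : δ 1 * δ a = δ a := by rw [← map_mul, one_mul]
  have δ_mul_one (a : A) : δ a * δ 1 = δ a := by rw [← map_mul, mul_one]
  let e : Equiv.Perm ((A →ₚ[ℂ] ℂ) × ℤ) := (Equiv.refl _).prodCongr (Equiv.addRight 1)
  have cases (n : ℤ) : (0 ≤ n ∧ (-n).toNat = 0 ∧ (-(n + 1)).toNat = 0 ∧
      (n + 1).toNat = n.toNat + 1) ∨ (¬ 0 ≤ n ∧ (-n).toNat = (-(n + 1)).toNat + 1 ∧
      n.toNat = 0 ∧ (n + 1).toNat = 0) := by omega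
  have he (f : A →ₚ[ℂ] ℂ) (n : ℤ) : e (f, n) = (f, n + 1) := rfl
  have hTT (x a y : A) : T x * (a * T y) = T (x * (δ a * y)) := by
    rw [← hT, ← hT, hc, ← mul_assoc, mul_assoc _ (δ 1) (δ a), δ_one_mul, mul_assoc, mul_assoc,
      hT, one_mul]
  obtain ⟨H, i₁, i₂, i₃, π, U, h₀, h⟩ := exists_covariant_representation_of_shift
    (δ := δ) (δs := T)
    (fun i : (A →ₚ[ℂ] ℂ) × ℤ => T.compIterate i.1 i.2.toNat) (fun i => δ ^ (-i.2).toNat) e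
    (fun i => if 0 ≤ i.2 then (δ : A →ₗ[ℂ] A) else .mulLeft ℂ ((δ ^ (-i.2).toNat) 1))
    (fun i => if 0 ≤ i.2 then T.toLinearMap else .id)
    (by
      rintro ⟨f, n⟩ x y
      obtain ⟨h₁, h₂, h₃, h₄⟩ | ⟨h₁, h₂, h₃, h₄⟩ := cases n
      · simp only [he, h₁, h₂, h₃, h₄, if_true, PositiveLinearMap.compIterate, pow_zero,
          NonUnitalStarAlgHom.one_apply, one_mul, PositiveLinearMap.comp_apply,
          PositiveLinearMap.coe_toLinearMap, LinearMap.coe_coe]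
        rw [← map_star, hT]
      · simp only [he, h₁, h₂, h₃, h₄, if_false, PositiveLinearMap.compIterate, δ_pow,
          LinearMap.mulLeft_apply, LinearMap.id_apply]
        rw [star_mul, ← map_star, ← map_star, star_one, mul_assoc, ← mul_assoc _ _ y, D_one])
    (by
      rintro ⟨f, n⟩ a x y
      obtain ⟨h₁, h₂, h₃, h₄⟩ | ⟨h₁, h₂, h₃, h₄⟩ := cases n
      · simp only [he, h₁, h₂, h₃, h₄, if_true, PositiveLinearMap.compIterate, pow_zero,
          NonUnitalStarAlgHom.one_apply, one_mul, PositiveLinearMap.comp_apply,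
          PositiveLinearMap.coe_toLinearMap, LinearMap.coe_coe]
        rw [← map_star, hT, star_mul, ← map_star, mul_assoc, hTT, star_mul, ← map_star, mul_assoc]
      · simp only [he, h₁, h₂, h₄, if_false, PositiveLinearMap.compIterate, δ_pow,
          LinearMap.mulLeft_apply, LinearMap.id_apply]
        rw [← mul_assoc _ _ x, ← map_mul, δ_one_mul])
    (by
      rintro ⟨f, n⟩ a x y
      obtain ⟨h₁, h₂, h₃, h₄⟩ | ⟨h₁, h₂, h₃, h₄⟩ := cases n
      · simp only [he, h₁, h₂, h₃, if_true, pow_zero,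
          NonUnitalStarAlgHom.one_apply, one_mul,
          PositiveLinearMap.coe_toLinearMap, LinearMap.coe_coe]
        rw [hT']
      · simp only [he, h₁, h₂, h₃, if_false, PositiveLinearMap.compIterate, δ_pow,
          LinearMap.mulLeft_apply, LinearMap.id_apply]
        congr 1
        simp only [star_mul, ← map_star, star_one, mul_assoc, hc]
        simp only [← mul_assoc, map_mul]
        simp only [mul_assoc _ ((δ ^ _) _) ((δ ^ _) _), ← map_mul, δ_one_mul, mul_assoc])
    (by
      rintro ⟨f, n⟩ a x y
      obtain ⟨h₁, h₂, h₃, h₄⟩ | ⟨h₁, h₂, h₃, h₄⟩ := cases n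
      · simp only [he, h₁, h₂, h₃, h₄, if_true, PositiveLinearMap.compIterate, pow_zero,
          NonUnitalStarAlgHom.one_apply, one_mul, PositiveLinearMap.comp_apply,
          PositiveLinearMap.coe_toLinearMap, LinearMap.coe_coe]
        rw [map_mul δ a x]
      · simp only [he, h₁, h₂, h₄, if_false, PositiveLinearMap.compIterate, δ_pow,
          LinearMap.mulLeft_apply]
        rw [← mul_assoc _ _ x, ← mul_assoc _ _ x, ← map_mul, δ_one_mul, ← map_mul, δ_mul_one])
  exact ⟨H, i₁, i₂, i₃, π, U, fun a ha f => h₀ a ha (f, 0), h⟩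

end Covariance

open scoped ComplexOrder ComplexStarModule in
/-- Positive functionals separate points of a C⋆-algebra. -/
theorem exists_positive_functional_apply_star_mul_self_ne_zero {A : Type*} [CStarAlgebra A]
    [PartialOrder A] [StarOrderedRing A] {a : A} (ha : a ≠ 0) :
    ∃ f : A →ₚ[ℂ] ℂ, f (star a * a) ≠ 0 := by
  have hmem : -(star a * a) ∉ {x : A | 0 ≤ x} := fun h => by
    have h0 : star a * a = 0 :=
      le_antisymm (by simpa using h) (star_mul_self_nonneg a)
    exact ha (CStarRing.star_mul_self_eq_zero_iff a |>.mp h0)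
  let C : ProperCone ℝ A := ProperCone.positive ℝ A
  obtain ⟨f, hf, hfa⟩ := C.hyperplane_separation_point (x₀ := -(star a * a))
    (by simpa [C] using hmem)
  replace hf : ∀ x : A, 0 ≤ x → 0 ≤ f x := fun x hx => hf x (by simpa [C] using hx)
  let g : A →ₗ[ℂ] ℂ :=
    { toFun x := f (ℜ x) + Complex.I * f (ℑ x)
      map_add' x y := by simp; ring
      map_smul' c x := by
        simp [realPart_smul, imaginaryPart_smul]
        apply Complex.ext <;> simp }
  have hg (x : A) (hx : 0 ≤ x) : g x = f x := by
    have hx' := IsSelfAdjoint.of_nonneg hx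
    simp [g, hx'.coe_realPart, hx'.imaginaryPart]
  refine ⟨.mk₀ g fun x hx => ?_, fun h => ?_⟩
  · rw [hg x hx]
    exact_mod_cast hf x hx
  · have h' : g (star a * a) = 0 := h
    rw [hg _ (star_mul_self_nonneg a)] at h'
    rw [map_neg, neg_lt_zero] at hfa
    exact hfa.ne' (by exact_mod_cast h')

/-- Sufficiency in the main theorem: if there exists a complete transfer
operator δ* for (A, δ), then A is a coefficient algebra associated with δ. -/
theorem coefficient_algebra_sufficiency {A : Type u} [CStarAlgebra A] [PartialOrder A]
    [StarOrderedRing A] (δ δs : A → A) (hδ : IsEndomorphism δ)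
    (hT : IsTransferOperator δ δs) (hc : ∀ a : A, δ (δs a) = δ 1 * a * δ 1) :
    ∃ (H : Type u) (_ : NormedAddCommGroup H) (_ : InnerProductSpace ℂ H)
      (_ : CompleteSpace H) (π : A →⋆ₐ[ℂ] (H →L[ℂ] H)) (U : H →L[ℂ] H),
      Function.Injective π ∧
      (∀ a : A, U * π a * star U = π (δ a)) ∧
      (∀ a : A, star U * π a * U = π (δs a)) ∧
      (∀ a : A, U * π a = π (δ a) * U) := by
  obtain ⟨δ_lin, δ_mul, δ_star⟩ := hδ
  obtain ⟨-, δs_lin, δs_pos, δs_transfer⟩ := hT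
  let D : A →⋆ₙₐ[ℂ] A :=
    { δ_lin.mk' δ with
      map_zero' := δ_lin.map_zero
      map_mul' := δ_mul
      map_star' := δ_star }
  let T : A →ₚ[ℂ] A := .mk₀ (δs_lin.mk' δs) δs_pos
  obtain ⟨H, i₁, i₂, i₃, π, U, hπ, hU⟩ := exists_covariant_representation D T δs_transfer hc
  refine ⟨H, i₁, i₂, i₃, π, U, (injective_iff_map_eq_zero π).mpr fun a ha => ?_, hU⟩
  by_contra h
  obtain ⟨f, hf⟩ := exists_positive_functional_apply_star_mul_self_ne_zero h
  exact hf (hπ a ha f)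
end

section
/- The following are equivalent: (1) there exist a complex Hilbert space H, an injective unital *-homomorphism π : A → B(H), and an isometry U ∈ B(H) (U*·U = 1) such that U·π(a)·U* = π(δ(a)) and U*·π(a)·U ∈ π(A) for every a ∈ A; (2) there exists a complete transfer operator δ* for (A, δ) with δ*(1) = 1; (3) δ is injective and δ(A) = {δ(1)·a·δ(1) : a ∈ A} (i.e. δ is a monomorphism with hereditary range). -/
section HilbertSum

open scoped InnerProductSpace

variable {ι : Type*} {E : ι → Type*} [∀ i, NormedAddCommGroup (E i)]

lemma lp.norm_sq_eq_tsum (x : lp E 2) : ‖x‖ ^ 2 = ∑' i, ‖x i‖ ^ 2 := by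
  have := lp.norm_rpow_eq_tsum (p := 2) (by norm_num) x
  simpa using this

lemma lp.summable_norm_sq (x : lp E 2) : Summable fun i => ‖x i‖ ^ 2 := by
  have := (lp.memℓp x).summable (p := 2) (by norm_num)
  simpa using this

lemma memℓp_two_of_summable {x : ∀ i, E i} (hx : Summable fun i => ‖x i‖ ^ 2) : Memℓp x 2 :=
  memℓp_gen (by simpa using hx)

variable [∀ i, InnerProductSpace ℂ (E i)]

/-- A uniformly bounded family of operators `T i : E (τ i) → E i`, indexed along an injective
map `τ`, acts on the Hilbert sum of the spaces `E i`. -/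
noncomputable def lp.weightedShift {τ : ι → ι} (hτ : τ.Injective) (T : ∀ i, E (τ i) →L[ℂ] E i)
    (C : ℝ) (hT : ∀ i, ‖T i‖ ≤ C) : lp E 2 →L[ℂ] lp E 2 :=
  have key (x : lp E 2) (i : ι) : ‖T i (x (τ i))‖ ^ 2 ≤ C ^ 2 * ‖x (τ i)‖ ^ 2 := by
    rw [← mul_pow]
    gcongr
    exact (T i).le_of_opNorm_le (hT i) _
  have hsum (x : lp E 2) : Summable fun i => C ^ 2 * ‖x (τ i)‖ ^ 2 :=
    ((lp.summable_norm_sq x).comp_injective hτ).mul_left _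
  have hsum' (x : lp E 2) : Summable fun i => ‖T i (x (τ i))‖ ^ 2 :=
    (hsum x).of_nonneg_of_le (fun _ => by positivity) (key x)
  LinearMap.mkContinuous
    { toFun := fun x => ⟨fun i => T i (x (τ i)), memℓp_two_of_summable (hsum' x)⟩
      map_add' := fun x y => lp.ext (funext fun i => map_add (T i) (x (τ i)) (y (τ i)))
      map_smul' := fun c x => lp.ext (funext fun i => map_smul (T i) c (x (τ i))) } |C| fun x => by
    refine le_of_sq_le_sq ?_ (by positivity)
    rw [mul_pow, sq_abs, lp.norm_sq_eq_tsum, lp.norm_sq_eq_tsum]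
    calc ∑' i, ‖T i (x (τ i))‖ ^ 2 ≤ ∑' i, C ^ 2 * ‖x (τ i)‖ ^ 2 :=
          (hsum' x).tsum_le_tsum (key x) (hsum x)
      _ = C ^ 2 * ∑' i, ‖x (τ i)‖ ^ 2 := tsum_mul_left
      _ ≤ C ^ 2 * ∑' i, ‖x i‖ ^ 2 := by
          refine mul_le_mul_of_nonneg_left ?_ (by positivity)
          exact tsum_comp_le_tsum_of_inj (lp.summable_norm_sq x) (fun _ => by positivity) hτ

@[simp]
lemma lp.weightedShift_apply {τ : ι → ι} (hτ : τ.Injective) (T : ∀ i, E (τ i) →L[ℂ] E i)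
    (C : ℝ) (hT : ∀ i, ‖T i‖ ≤ C) (x : lp E 2) (i : ι) :
    lp.weightedShift hτ T C hT x i = T i (x (τ i)) := rfl

end HilbertSum

section Representations

open scoped InnerProductSpace ComplexOrder
open ContinuousLinearMap UniformSpace

universe v w

/-- A representation of `A` on a Hilbert space, allowed to be degenerate. -/
structure HilbertRep (A : Type v) [CStarAlgebra A] where
  /-- The underlying Hilbert space. -/
  space : Type w
  [normed : NormedAddCommGroup space]
  [inner : InnerProductSpace ℂ space]
  [complete : CompleteSpace space]
  /-- The action of the algebra. -/
  hom : A →⋆ₙₐ[ℂ] (space →L[ℂ] space)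

namespace HilbertRep

attribute [instance] normed inner complete

variable {A : Type v} [CStarAlgebra A] (δ : A →⋆ₙₐ[ℂ] A) (L : A → A)

/-- `Implements δ L r s T` says that the partial isometry `T` intertwines `r` with `s ∘ δ`, with
final projection `s (δ 1)`, and that compression by `T` implements `L`. -/
structure Implements (r s : HilbertRep.{v, w} A) (T : r.space →L[ℂ] s.space) : Prop where
  intertwines (a : A) (x : r.space) : s.hom (δ a) (T x) = T (r.hom a x)
  compresses (a : A) (x y : r.space) : ⟪T x, s.hom a (T y)⟫_ℂ = ⟪x, r.hom (L a) y⟫_ℂ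
  nondegenerate (x : r.space) : s.hom (δ 1) (T x) = T x
  final (x : s.space) : T (adjoint T x) = s.hom (δ 1) x

variable {δ L}

lemma Implements.norm_le {r s : HilbertRep.{v, w} A} {T : r.space →L[ℂ] s.space}
    (h : Implements δ L r s T) : ‖T‖ ≤ 1 + ‖(1 : A)‖ := by
  have h1 : T ∘L adjoint T = s.hom (δ 1) := by ext x; exact h.final x
  have h2 : ‖T‖ * ‖T‖ = ‖s.hom (δ 1)‖ := by
    rw [← h1]
    have := norm_adjoint_comp_self (adjoint T)
    rw [adjoint_adjoint] at this
    rw [this, LinearIsometryEquiv.norm_map]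
  have h3 : ‖s.hom (δ 1)‖ ≤ ‖(1 : A)‖ :=
    (NonUnitalStarAlgHom.norm_apply_le s.hom _).trans (NonUnitalStarAlgHom.norm_apply_le δ _)
  nlinarith [norm_nonneg T, norm_nonneg (1 : A)]

/-- The diagonal action on the Hilbert sum of a family of representations. -/
noncomputable def sumHom {ι : Type w} (r : ι → HilbertRep.{v, w} A) :
    A →⋆ₙₐ[ℂ] (lp (fun i => (r i).space) 2 →L[ℂ] lp (fun i => (r i).space) 2) where
  toFun a := lp.weightedShift Function.injective_id (fun i => (r i).hom a) ‖a‖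
    fun i => NonUnitalStarAlgHom.norm_apply_le (r i).hom a
  map_smul' c a := by ext x i; simp
  map_zero' := by ext x i; simp
  map_add' a b := by ext x i; simp
  map_mul' a b := by ext x i; simp
  map_star' a := by
    refine (eq_adjoint_iff _ _).mpr fun x y => ?_
    rw [lp.inner_eq_tsum, lp.inner_eq_tsum]
    refine tsum_congr fun i => ?_
    simp [map_star, star_eq_adjoint, adjoint_inner_left]

lemma sumHom_apply {ι : Type w} (r : ι → HilbertRep.{v, w} A) (a : A)
    (x : lp (fun i => (r i).space) 2) (i : ι) : sumHom r a x i = (r i).hom a (x i) := rfl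

/-- The Hilbert sum of a family of representations. -/
noncomputable def sum {ι : Type w} (r : ι → HilbertRep.{v, w} A) : HilbertRep.{v, w} A where
  space := lp (fun i => (r i).space) 2
  hom := sumHom r

lemma hom_eq_zero_of_sum_hom_eq_zero {ι : Type w} (r : ι → HilbertRep.{v, w} A) {a : A}
    (h : (sum r).hom a = 0) (i : ι) : (r i).hom a = 0 := by
  classical
  ext x
  have h1 := sumHom_apply r a (lp.single 2 i x) i
  rw [show sumHom r a = 0 from h] at h1
  simpa using h1.symm

lemma exists_implements_sum {ι : Type w} (r : ι → HilbertRep.{v, w} A) (τ : Equiv.Perm ι)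
    (hL : L 1 = 1) (h : ∀ i, ∃ T, Implements δ L (r (τ i)) (r i) T) :
    ∃ W, Implements δ L (sum r) (sum r) W := by
  choose T hT using h
  let E : ι → Type w := fun i => (r i).space
  let W : lp E 2 →L[ℂ] lp E 2 := lp.weightedShift τ.injective T _ fun i => (hT i).norm_le
  have hτ (j : ι) : τ (τ.symm j) = j := τ.apply_symm_apply j
  let S (i j : ι) (hij : τ i = j) : E i →L[ℂ] E j := hij ▸ adjoint (T i)
  have hS (i j : ι) (hij : τ i = j) : ‖S i j hij‖ ≤ 1 + ‖(1 : A)‖ := by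
    subst hij
    simpa [S] using (hT i).norm_le
  have hTS (x : lp E 2) (i k : ι) (hk : k = i) (hki : τ k = τ i) :
      T i (S k (τ i) hki (x k)) = (r i).hom (δ 1) (x i) := by
    subst hk
    exact (hT k).final _
  let W' : lp E 2 →L[ℂ] lp E 2 :=
    lp.weightedShift τ.symm.injective (fun j => S (τ.symm j) j (hτ j)) _ fun j => hS _ _ _
  have hWW' : W * W' = sumHom r (δ 1) := by
    ext x i
    exact hTS x i _ (τ.symm_apply_apply i) _
  have inter (a : A) : sumHom r (δ a) * W = W * sumHom r a := by
    ext x i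
    exact (hT i).intertwines a _
  have nondeg : sumHom r (δ 1) * W = W := by
    ext x i
    exact (hT i).nondegenerate _
  have comp (a : A) (x y : lp E 2) : ⟪W x, sumHom r a (W y)⟫_ℂ = ⟪x, sumHom r (L a) y⟫_ℂ := by
    rw [lp.inner_eq_tsum, lp.inner_eq_tsum]
    refine Eq.trans (tsum_congr fun i => (hT i).compresses a (x (τ i)) (y (τ i))) ?_
    exact τ.tsum_eq fun i => ⟪x i, (r i).hom (L a) (y i)⟫_ℂ
  have hWW : star W * W = sumHom r 1 := by
    have h1 : sumHom r 1 * W = W := by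
      rw [← nondeg, ← mul_assoc, ← map_mul, one_mul]
    ext1 y
    refine ext_inner_left ℂ fun x => ?_
    change ⟪x, adjoint W (W y)⟫_ℂ = _
    rw [adjoint_inner_right, ← hL, ← comp 1 x y]
    congr 1
    exact (DFunLike.congr_fun h1 y).symm
  have h2 : W * star W * sumHom r (δ 1) = sumHom r (δ 1) := by
    rw [← hWW', mul_assoc, ← mul_assoc (star W), hWW, ← mul_assoc, ← inter, nondeg]
  have h3 : W * star W = sumHom r (δ 1) := by
    have h4 := congrArg star h2
    rwa [star_mul, star_mul, star_star, ← map_star, ← map_star, star_one, ← mul_assoc,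
      nondeg] at h4
  exact ⟨W, fun a x => DFunLike.congr_fun (inter a) x, comp,
    fun x => DFunLike.congr_fun nondeg x, fun x => DFunLike.congr_fun h3 x⟩

/-- The degenerate representation obtained by composing with the endomorphism. -/
noncomputable def precomp (δ : A →⋆ₙₐ[ℂ] A) (r : HilbertRep.{v, w} A) : HilbertRep.{v, w} A where
  space := r.space
  hom := r.hom.comp δ

lemma implements_precomp (hc : ∀ a, δ (L a) = δ 1 * a * δ 1) (r : HilbertRep.{v, w} A) :
    Implements δ L (precomp δ r) r (r.hom (δ 1)) where
  intertwines a x := by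
    change (r.hom (δ a) * r.hom (δ 1)) x = (r.hom (δ 1) * r.hom (δ a)) x
    simp only [← map_mul, mul_one, one_mul]
  compresses a x y := by
    have h1 : r.hom (δ (L a)) = star (r.hom (δ 1)) * r.hom a * r.hom (δ 1) := by
      rw [hc, map_mul, map_mul, ← map_star, ← map_star, star_one]
    change _ = ⟪x, r.hom (δ (L a)) y⟫_ℂ
    rw [h1]
    exact (adjoint_inner_right (r.hom (δ 1)) x _).symm
  nondegenerate x := by
    change (r.hom (δ 1) * r.hom (δ 1)) x = _
    rw [← map_mul, ← map_mul, mul_one]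
    rfl
  final x := by
    change (r.hom (δ 1) * star (r.hom (δ 1))) x = _
    rw [← map_star, ← map_star, star_one, ← map_mul, ← map_mul, mul_one]

/-- A projection is of the form `J ∘ J†` for an isometry `J`. -/
lemma exists_isometry_of_projection {H : Type w} [NormedAddCommGroup H] [InnerProductSpace ℂ H]
    [CompleteSpace H] {P : H →L[ℂ] H} (hP : P * P = P) (hPs : star P = P) :
    ∃ (K : Type w) (_ : NormedAddCommGroup K) (_ : InnerProductSpace ℂ K) (_ : CompleteSpace K)
      (J : K →L[ℂ] H), adjoint J ∘L J = 1 ∧ J ∘L adjoint J = P := by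
  let K : Submodule ℂ H := (1 - P).ker
  have hK (x : H) : x ∈ K ↔ P x = x := by
    change x - P x = 0 ↔ _
    rw [sub_eq_zero, eq_comm]
  have : CompleteSpace K := (1 - P).isClosed_ker.completeSpace_coe
  refine ⟨K, inferInstance, inferInstance, this, K.subtypeL, ?_, ?_⟩
  · ext1 y
    refine ext_inner_left ℂ fun x => ?_
    exact adjoint_inner_right K.subtypeL x _
  · ext z
    have hz : P z ∈ K := (hK _).mpr (DFunLike.congr_fun hP z)
    suffices h : adjoint K.subtypeL z = ⟨P z, hz⟩ by simp [h]
    refine ext_inner_left ℂ fun x => ?_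
    rw [adjoint_inner_right]
    change ⟪(x : H), z⟫_ℂ = ⟪(x : H), P z⟫_ℂ
    rw [← hPs, star_eq_adjoint, adjoint_inner_right, (hK _).mp x.2]

/-- An implemented representation restricts to a nondegenerate one on the range of `hom 1`. -/
lemma exists_isometry_of_implements {r : HilbertRep.{v, w} A} {W : r.space →L[ℂ] r.space}
    (hr : Function.Injective r.hom) (hL : L 1 = 1) (hW : Implements δ L r r W) :
    ∃ (H : Type w) (_ : NormedAddCommGroup H) (_ : InnerProductSpace ℂ H)
      (_ : CompleteSpace H) (π : A →⋆ₐ[ℂ] (H →L[ℂ] H)) (U : H →L[ℂ] H),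
      Function.Injective π ∧ star U * U = 1 ∧ (∀ a : A, U * π a * star U = π (δ a)) ∧
      ∀ a : A, star U * π a * U ∈ Set.range π := by
  set P := r.hom 1 with hP
  have hPP : P * P = P := by rw [hP, ← map_mul, one_mul]
  have hPs : star P = P := by rw [hP, ← map_star, star_one]
  have hPr (a : A) : P * r.hom a = r.hom a := by rw [hP, ← map_mul, one_mul]
  have hrP (a : A) : r.hom a * P = r.hom a := by rw [hP, ← map_mul, mul_one]
  have inter (a : A) : r.hom (δ a) * W = W * r.hom a := by
    ext x; exact hW.intertwines a x
  have comp (a : A) : star W * r.hom a * W = r.hom (L a) := by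
    ext1 y
    refine ext_inner_left ℂ fun x => ?_
    rw [← hW.compresses]
    exact adjoint_inner_right W x _
  have nondeg : r.hom (δ 1) * W = W := by ext x; exact hW.nondegenerate x
  have final : W * star W = r.hom (δ 1) := by ext x; exact hW.final x
  have hPW : P * W = W := by rw [← nondeg, ← mul_assoc, hPr]
  obtain ⟨K, _, _, _, J, hJ, hJP⟩ : ∃ (K : Type w) (_ : NormedAddCommGroup K)
      (_ : InnerProductSpace ℂ K) (_ : CompleteSpace K) (J : K →L[ℂ] r.space),
      adjoint J ∘L J = 1 ∧ J ∘L adjoint J = P := exists_isometry_of_projection hPP hPs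
  let c (X : r.space →L[ℂ] r.space) : K →L[ℂ] K := adjoint J ∘L X ∘L J
  have c_mul (X Y) : c X * c Y = c (X * P * Y) := by
    rw [← hJP]; rfl
  have c_star (X) : star (c X) = c (star X) := by
    simp only [c, star_eq_adjoint, adjoint_comp, adjoint_adjoint]; rfl
  have c_P : c P = 1 := by
    rw [← hJP]
    change (adjoint J ∘L J) ∘L (adjoint J ∘L J) = 1
    rw [hJ]; rfl
  let π : A →⋆ₐ[ℂ] (K →L[ℂ] K) :=
    { toFun := fun a => c (r.hom a)
      map_one' := c_P
      map_mul' := fun a b => by rw [c_mul, hrP, map_mul]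
      map_zero' := by simp [c]
      map_add' := fun a b => by ext x; simp [c]
      commutes' := fun z => by
        rw [Algebra.algebraMap_eq_smul_one, Algebra.algebraMap_eq_smul_one, map_smul, ← c_P]
        ext x
        simp [c, hP]
      map_star' := fun a => by rw [map_star, c_star] }
  refine ⟨K, _, _, _, π, c W, ?_, ?_, fun a => ?_, fun a => ⟨L a, ?_⟩⟩
  · refine (injective_iff_map_eq_zero π).mpr fun a ha => ?_
    refine (injective_iff_map_eq_zero r.hom).mp hr a ?_
    have h1 : J ∘L c (r.hom a) ∘L adjoint J = P * r.hom a * P := by rw [← hJP]; rfl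
    rw [hPr, hrP, show c (r.hom a) = 0 from ha] at h1
    simpa using h1.symm
  · rw [c_star, c_mul, comp, hL, c_P]
  · change c W * c (r.hom a) * star (c W) = c (r.hom (δ a))
    rw [c_star, c_mul, c_mul, mul_assoc W, hPr, mul_assoc W (r.hom a) P, hrP, ← inter,
      mul_assoc, final, ← map_mul, ← map_mul, mul_one]
  · change c (r.hom (L a)) = star (c W) * c (r.hom a) * c W
    rw [c_star, c_mul, c_mul, mul_assoc _ P, hPW, mul_assoc _ P, hPr, comp]

end HilbertRep

section GNS

variable {A : Type v} [CStarAlgebra A] [PartialOrder A] [StarOrderedRing A]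

/-- The GNS representation, as a `HilbertRep`. -/
noncomputable def gnsRep (f : A →ₚ[ℂ] ℂ) : HilbertRep.{v, v} A where
  space := f.GNS
  hom := f.gnsNonUnitalStarAlgHom

variable {δ : A →⋆ₙₐ[ℂ] A} {L : A →ₚ[ℂ] A}

lemma exists_implements_gnsRep (hL : ∀ a, L (δ a) = a) (hc : ∀ a, δ (L a) = δ 1 * a * δ 1)
    (f : A →ₚ[ℂ] ℂ) :
    ∃ T, HilbertRep.Implements δ L (gnsRep f) (gnsRep (f.comp L)) T := by
  have hinj : Function.Injective δ := Function.LeftInverse.injective hL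
  have h1 (a : A) : δ 1 * δ a = δ a := by rw [← map_mul, one_mul]
  have h1' (a : A) : δ a * δ 1 = δ a := by rw [← map_mul, mul_one]
  have hs : star (δ 1) = δ 1 := by rw [← map_star, star_one]
  have hleft (a b : A) : L (δ a * b) = a * L b := hinj (by
    rw [hc, map_mul, hc, ← mul_assoc, ← mul_assoc, ← mul_assoc, h1, h1'])
  have hright (a b : A) : L (b * δ a) = L b * a := hinj (by
    rw [hc, map_mul, hc, mul_assoc _ (δ 1) (δ a), h1, mul_assoc _ _ (δ 1), mul_assoc _ _ (δ 1), h1',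
      ← mul_assoc])
  have hstar (a : A) : L (star a) = star (L a) := hinj (by
    rw [hc, map_star, hc, star_mul, star_mul, hs, mul_assoc])
  let g := f.comp L
  have hg (a : A) : g a = f (L a) := rfl
  let T₀ : f.PreGNS →L[ℂ] g.PreGNS := LinearMap.mkContinuous
    (g.toPreGNS.toLinearMap ∘ₗ (δ : A →ₗ[ℂ] A) ∘ₗ f.ofPreGNS.toLinearMap) 1 fun x => by
      rw [one_mul, PositiveLinearMap.preGNS_norm_def, PositiveLinearMap.preGNS_norm_def]
      simp [← map_star, ← map_mul, hg, hL]
  have hT₀ (a : f.PreGNS) : T₀ a = g.toPreGNS (δ (f.ofPreGNS a)) := rfl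
  let T : f.GNS →L[ℂ] g.GNS := T₀.completion
  have hT (a : f.PreGNS) : T (a : f.GNS) = ((T₀ a : g.PreGNS) : g.GNS) :=
    T₀.completion_apply_coe a
  have hadj (a : g.PreGNS) :
      adjoint T (a : g.GNS) = ((f.toPreGNS (L (g.ofPreGNS a)) : f.PreGNS) : f.GNS) := by
    refine ext_inner_left ℂ fun x => ?_
    induction x using Completion.induction_on with
    | hp => apply isClosed_eq <;> fun_prop
    | ih x =>
      rw [adjoint_inner_right, hT, Completion.inner_coe, Completion.inner_coe,
        PositiveLinearMap.preGNS_inner_def, PositiveLinearMap.preGNS_inner_def, hT₀, hg]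
      simp [← map_star, hleft]
  have e1 (a : A) (x : f.GNS) :
      g.gnsNonUnitalStarAlgHom (δ a) (T x) = T (f.gnsNonUnitalStarAlgHom a x) := by
    induction x using Completion.induction_on with
    | hp => apply isClosed_eq <;> fun_prop
    | ih x => simp [hT, hT₀]
  have e2 (a : A) (x y : f.GNS) :
      ⟪T x, g.gnsNonUnitalStarAlgHom a (T y)⟫_ℂ = ⟪x, f.gnsNonUnitalStarAlgHom (L a) y⟫_ℂ := by
    induction x, y using Completion.induction_on₂ with
    | hp => apply isClosed_eq <;> fun_prop
    | ih x y =>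
      simp [hT, hT₀, PositiveLinearMap.preGNS_inner_def, ← map_star, hleft, hright, hg]
  have e3 (x : f.GNS) : g.gnsNonUnitalStarAlgHom (δ 1) (T x) = T x := by
    induction x using Completion.induction_on with
    | hp => apply isClosed_eq <;> fun_prop
    | ih x => simp [hT, hT₀, h1]
  have e4 (x : g.GNS) : T (adjoint T x) = g.gnsNonUnitalStarAlgHom (δ 1) x := by
    refine ext_inner_left ℂ fun y => ?_
    induction y, x using Completion.induction_on₂ with
    | hp => apply isClosed_eq <;> fun_prop
    | ih y x =>
      rw [← adjoint_inner_left, hadj, hadj]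
      simp only [Completion.inner_coe, PositiveLinearMap.preGNS_inner_def,
        PositiveLinearMap.gnsNonUnitalStarAlgHom_apply_coe, hg,
        PositiveLinearMap.leftMulMapPreGNS_apply, PositiveLinearMap.ofPreGNS_toPreGNS, ← hstar]
      congr 1
      refine hinj ?_
      have hp (z : A) : δ 1 * (δ 1 * z) = δ 1 * z := by rw [← mul_assoc, h1]
      simp only [map_mul, hc, mul_assoc, hp]
  exact ⟨T, e1, e2, e3, e4⟩

/-- Positive functionals detect nonzero elements of the form `star a * a`. -/
lemma exists_positive_apply_star_mul_self_ne_zero {a : A} (ha : a ≠ 0) :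
    ∃ f : A →ₚ[ℂ] ℂ, f (star a * a) ≠ 0 := by
  have hneg : -(star a * a) ∉ {x : A | 0 ≤ x} := fun h => ha <|
    (CStarRing.star_mul_self_eq_zero_iff a).mp
      (le_antisymm (neg_nonneg.mp h) (star_mul_self_nonneg a))
  obtain ⟨g, u, hu, hg⟩ := RCLike.geometric_hahn_banach_point_closed (𝕜 := ℂ)
    (convex_Ici (𝕜 := ℝ) (0 : A)) CStarAlgebra.isClosed_nonneg hneg
  have hu0 : u < 0 := by simpa using hg 0 le_rfl
  have hgpos (x : A) (hx : 0 ≤ x) : 0 ≤ (g x).re := by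
    by_contra! hlt
    have h1 := hg (((u / (g x).re : ℝ)) • x)
      (smul_nonneg (div_nonneg_of_nonpos hu0.le hlt.le) hx)
    rw [← Complex.coe_smul, map_smul] at h1
    simp [div_mul_cancel₀ _ hlt.ne] at h1
  let f₀ : A →ₗ[ℂ] ℂ :=
    { toFun := fun x => g x + star (g (star x))
      map_add' := fun x y => by simp; ring
      map_smul' := fun c x => by simp; ring }
  have hf₀ (x : A) (hx : IsSelfAdjoint x) : f₀ x = ((2 * (g x).re : ℝ) : ℂ) := by
    change g x + star (g (star x)) = _
    rw [hx.star_eq]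
    exact Complex.add_conj _
  refine ⟨.mk₀ f₀ fun x hx => ?_, ?_⟩
  · rw [hf₀ x (.of_nonneg hx)]
    exact_mod_cast mul_nonneg zero_le_two (hgpos x hx)
  · change f₀ (star a * a) ≠ 0
    rw [hf₀ _ (.star_mul_self a)]
    have : (g (-(star a * a))).re < 0 := hu.trans hu0
    rw [map_neg, Complex.neg_re] at this
    exact_mod_cast (by linarith : 0 < 2 * (g (star a * a)).re).ne'

lemma apply_star_mul_self_eq_zero_of_gnsRep {f : A →ₚ[ℂ] ℂ} {a : A} (h : (gnsRep f).hom a = 0) :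
    f (star a * a) = 0 := by
  have h1 : f.gnsNonUnitalStarAlgHom a (f.toPreGNS 1 : f.GNS) = 0 := by
    rw [show f.gnsNonUnitalStarAlgHom a = 0 from h]; rfl
  have h2 : ‖f.toPreGNS a‖ = 0 := by
    rw [← Completion.norm_coe, show (f.toPreGNS a : f.GNS) = 0 by simpa using h1, norm_zero]
  simpa [h2] using (f.preGNS_norm_sq (f.toPreGNS a)).symm

/-- The two-sided orbit of the GNS representation of `f` under an endomorphism `δ` with
transfer operator `L`. -/
noncomputable def gnsOrbit (δ : A →⋆ₙₐ[ℂ] A) (L : A →ₚ[ℂ] A) (f : A →ₚ[ℂ] ℂ) :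
    ℤ → HilbertRep.{v, v} A
  | .ofNat n => gnsRep ((fun g => g.comp L)^[n] f)
  | .negSucc n => (HilbertRep.precomp δ)^[n + 1] (gnsRep f)

lemma exists_implements_gnsOrbit (hL : ∀ a, L (δ a) = a) (hc : ∀ a, δ (L a) = δ 1 * a * δ 1)
    (f : A →ₚ[ℂ] ℂ) (n : ℤ) :
    ∃ T, HilbertRep.Implements δ L (gnsOrbit δ L f n) (gnsOrbit δ L f (n + 1)) T := by
  match n with
  | .ofNat n =>
    have h : gnsOrbit δ L f (.ofNat n + 1) = gnsRep (((fun g => g.comp L)^[n] f).comp L) :=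
      congrArg gnsRep (Function.iterate_succ_apply' (fun g : A →ₚ[ℂ] ℂ => g.comp L) n f)
    rw [h]
    exact exists_implements_gnsRep hL hc _
  | .negSucc 0 => exact ⟨_, HilbertRep.implements_precomp hc (gnsRep f)⟩
  | .negSucc (n + 1) =>
    have h : gnsOrbit δ L f (.negSucc (n + 1)) =
        HilbertRep.precomp δ (gnsOrbit δ L f (.negSucc n)) :=
      Function.iterate_succ_apply' (HilbertRep.precomp δ) (n + 1) (gnsRep f)
    rw [h]
    exact ⟨_, HilbertRep.implements_precomp hc _⟩

lemma exists_isometry_of_complete_transfer (hL : ∀ a, L (δ a) = a)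
    (hc : ∀ a, δ (L a) = δ 1 * a * δ 1) (h1 : L 1 = 1) :
    ∃ (H : Type v) (_ : NormedAddCommGroup H) (_ : InnerProductSpace ℂ H)
      (_ : CompleteSpace H) (π : A →⋆ₐ[ℂ] (H →L[ℂ] H)) (U : H →L[ℂ] H),
      Function.Injective π ∧ star U * U = 1 ∧ (∀ a : A, U * π a * star U = π (δ a)) ∧
      ∀ a : A, star U * π a * U ∈ Set.range π := by
  let r (i : (A →ₚ[ℂ] ℂ) × ℤ) : HilbertRep.{v, v} A := gnsOrbit δ L i.1 i.2
  obtain ⟨W, hW⟩ := HilbertRep.exists_implements_sum r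
    (Equiv.prodCongr (Equiv.refl _) (Equiv.subRight 1)) h1 fun i => by
      have h := exists_implements_gnsOrbit hL hc i.1 (i.2 - 1)
      rwa [sub_add_cancel] at h
  refine HilbertRep.exists_isometry_of_implements ?_ h1 hW
  refine (injective_iff_map_eq_zero _).mpr fun a ha => ?_
  by_contra hne
  obtain ⟨f, hf⟩ := exists_positive_apply_star_mul_self_ne_zero hne
  exact hf (apply_star_mul_self_eq_zero_of_gnsRep
    (HilbertRep.hom_eq_zero_of_sum_hom_eq_zero r ha (f, 0)))

end GNS

end Representations

section Transfer

variable {A B : Type*} [CStarAlgebra A] [PartialOrder A] [StarOrderedRing A]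
  [CStarAlgebra B] [PartialOrder B] [StarOrderedRing B]

lemma nonneg_of_map_nonneg (φ : A →⋆ₙₐ[ℂ] B) (hφ : Function.Injective φ) {y : A}
    (hy : 0 ≤ φ y) : 0 ≤ y := by
  have hsa : IsSelfAdjoint y := hφ (by rw [map_star, (IsSelfAdjoint.of_nonneg hy).star_eq])
  set n := y⁻ with hn
  have hn0 : 0 ≤ n := CFC.negPart_nonneg y
  have hns : star n = n := (IsSelfAdjoint.of_nonneg hn0).star_eq
  have hy' : n * y * n = -(n * n * n) := by
    conv_lhs => rw [← CFC.posPart_sub_negPart y hsa]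
    rw [mul_sub, CFC.negPart_mul_posPart, zero_sub, neg_mul]
  have key (z : A) (hz : 0 ≤ φ z) : 0 ≤ φ (n * z * n) := by
    have := star_left_conjugate_nonneg hz (φ n)
    rwa [← map_star, hns, ← map_mul, ← map_mul] at this
  have hφn : 0 ≤ φ n := map_nonneg φ hn0
  have h1 : φ (n * n * n) = 0 := by
    refine le_antisymm ?_ (key n hφn)
    have := key y hy
    rwa [hy', map_neg, neg_nonneg] at this
  have h2 : n * n * n = 0 := hφ (by rw [h1, map_zero])
  have h3 : n * n = 0 := by
    rw [← CStarRing.star_mul_self_eq_zero_iff, star_mul, hns, ← mul_assoc, h2, zero_mul]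
  have h4 : n = 0 := by rwa [← CStarRing.star_mul_self_eq_zero_iff, hns]
  exact (CFC.negPart_eq_zero_iff y hsa).mp h4

/-- If compression by `v` maps `A` into the range of an embedding `φ`, pulling it back along `φ`
gives a continuous positive linear map. -/
lemma exists_positive_of_conjugate_mem_range (φ ψ : A →⋆ₙₐ[ℂ] B) (hφ : Function.Injective φ)
    (v : B) (h : ∀ a, star v * ψ a * v ∈ Set.range φ) :
    ∃ L : A → A, Continuous L ∧ IsLinearMap ℂ L ∧ (∀ a, 0 ≤ a → 0 ≤ L a) ∧
      ∀ a, φ (L a) = star v * ψ a * v := by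
  choose L hL using h
  have hψ : Continuous ψ := map_continuous ψ
  refine ⟨L, ?_, ⟨fun a b => hφ ?_, fun c a => hφ ?_⟩, fun a ha => ?_, hL⟩
  · rw [(NonUnitalStarAlgHom.isometry φ hφ).isEmbedding.continuous_iff]
    have : φ ∘ L = fun a => star v * ψ a * v := funext hL
    rw [this]
    fun_prop
  · rw [hL, map_add, map_add, hL, hL, mul_add, add_mul]
  · rw [hL, map_smul, map_smul, hL, mul_smul_comm, smul_mul_assoc]
  · refine nonneg_of_map_nonneg φ hφ ?_
    rw [hL]
    exact star_left_conjugate_nonneg (map_nonneg ψ ha) v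

end Transfer

universe u

/-- An endomorphism δ is generated by an isometry iff there exists a complete
transfer operator δ* for (A, δ) with δ*(1) = 1, iff δ is a monomorphism with
hereditary range. -/
theorem generated_by_isometry_iff {A : Type u} [CStarAlgebra A] [PartialOrder A]
    [StarOrderedRing A] (δ : A → A) (hδ : IsEndomorphism δ) :
    ((∃ (H : Type u) (_ : NormedAddCommGroup H) (_ : InnerProductSpace ℂ H)
        (_ : CompleteSpace H) (π : A →⋆ₐ[ℂ] (H →L[ℂ] H)) (U : H →L[ℂ] H),
        Function.Injective π ∧ star U * U = 1 ∧
        (∀ a : A, U * π a * star U = π (δ a)) ∧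
        (∀ a : A, star U * π a * U ∈ Set.range π)) ↔
      (∃ δs : A → A, IsTransferOperator δ δs ∧
        (∀ a : A, δ (δs a) = δ 1 * a * δ 1) ∧ δs 1 = 1)) ∧
    ((∃ δs : A → A, IsTransferOperator δ δs ∧
        (∀ a : A, δ (δs a) = δ 1 * a * δ 1) ∧ δs 1 = 1) ↔
      (Function.Injective δ ∧
        Set.range δ = {x : A | ∃ a : A, x = δ 1 * a * δ 1})) := by
  let D : A →⋆ₙₐ[ℂ] A :=
    { toFun := δ
      map_smul' := hδ.1.map_smul
      map_zero' := hδ.1.map_zero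
      map_add' := hδ.1.map_add
      map_mul' := hδ.2.1
      map_star' := hδ.2.2 }
  have hmul (a b : A) : δ (a * b) = δ a * δ b := hδ.2.1 a b
  have hp : δ 1 * δ 1 = δ 1 := by rw [← hmul, one_mul]
  have hps : star (δ 1) = δ 1 := by rw [← hδ.2.2, star_one]
  have transfer_inv {δs : A → A} (h : IsTransferOperator δ δs) (h1 : δs 1 = 1) (a : A) :
      δs (δ a) = a := by
    have := h.2.2.2 a 1
    rwa [mul_one, h1, mul_one] at this
  refine ⟨⟨?_, ?_⟩, ?_, ?_⟩
  · rintro ⟨H, _, _, _, π, U, hπ, hU, hδU, hUr⟩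
    obtain ⟨L, hLc, hLl, hLp, hL⟩ :=
      exists_positive_of_conjugate_mem_range (π : A →⋆ₙₐ[ℂ] (H →L[ℂ] H)) π hπ U hUr
    replace hL (a : A) : π (L a) = star U * π a * U := hL a
    refine ⟨L, ⟨hLc, hLl, hLp, fun a b => hπ ?_⟩, fun a => hπ ?_, hπ ?_⟩
    · rw [hL, map_mul, ← hδU, map_mul, hL]
      simp only [← mul_assoc]
      rw [hU, one_mul]
    · rw [← hδU, hL, map_mul, map_mul, ← hδU, map_one, mul_one]
      simp only [mul_assoc]
    · rw [hL, map_one, mul_one, hU]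
  · rintro ⟨δs, h, hc, h1⟩
    open scoped ComplexOrder in
    exact exists_isometry_of_complete_transfer (δ := D)
      (L := .mk₀ (IsLinearMap.mk' δs h.2.1) h.2.2.1) (transfer_inv h h1) hc h1
  · rintro ⟨δs, h, hc, h1⟩
    refine ⟨Function.LeftInverse.injective (transfer_inv h h1), Set.ext fun x => ⟨?_, ?_⟩⟩
    · rintro ⟨a, rfl⟩
      exact ⟨δ a, by rw [← hmul, ← hmul, one_mul, mul_one]⟩
    · rintro ⟨a, rfl⟩
      exact ⟨δs a, hc a⟩
  · rintro ⟨hinj, hr⟩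
    obtain ⟨L, hLc, hLl, hLp, hL⟩ := exists_positive_of_conjugate_mem_range D (.id ℂ A) hinj (δ 1)
      fun a => by
        change _ ∈ Set.range δ
        rw [hr, hps]
        exact ⟨a, rfl⟩
    replace hL (a : A) : δ (L a) = δ 1 * a * δ 1 := (hL a).trans (by rw [hps]; rfl)
    refine ⟨L, ⟨hLc, hLl, hLp, fun a b => hinj ?_⟩, hL, hinj ?_⟩
    · rw [hL, hmul, hL]
      simp only [← mul_assoc, ← hmul, one_mul, mul_one]
    · rw [hL, mul_one, hp]
end
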